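/- For the weakly self-avoiding walk with parameter β ∈ (0,1) in any dimension d ≥ 1, the torus two-point function is dominated by the unfolded sum: G_z^𝕋(x) ≤ ∑_{u ∈ ℤ^d} G_z(x + r·u) for all z ≥ 0, r ≥ 3, and x ∈ [−r/2, r/2)^d ∩ ℤ^d. In particular the torus susceptibility satisfies χ^𝕋(z) ≤ χ(z) for z ∈ [0, z_c]. -/

import Mathlib

open scoped ENNReal

/-- The weakly self-avoiding walk interaction weight
`∏_{0 ≤ s < t ≤ n} (1 + β U_{st}(ω))`. -/
noncomputable def Kint {V : Type*} [DecidableEq V] (β : ℝ) (n : ℕ)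
    (ω : Fin (n + 1) → V) : ℝ :=
  ∏ p ∈ Finset.univ.filter (fun p : Fin (n + 1) × Fin (n + 1) => p.1 < p.2),
    (1 + β * (if ω p.1 = ω p.2 then (-1 : ℝ) else 0))

/-- `ω` is an `n`-step nearest-neighbour walk on `ℤ^d` started at `0`. -/
def IsZWalk (d n : ℕ) (ω : Fin (n + 1) → Fin d → ℤ) : Prop :=
  ω 0 = 0 ∧ ∀ i : Fin n, (∑ j, |ω i.succ j - ω i.castSucc j|) = 1

/-- `ω` is an `n`-step nearest-neighbour walk on the torus `(ℤ/rℤ)^d` started at `0`. -/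
def IsTWalk (d r n : ℕ) (ω : Fin (n + 1) → Fin d → ZMod r) : Prop :=
  ω 0 = 0 ∧ ∀ i : Fin n, ∃ e : Fin d → ℤ, (∑ j, |e j|) = 1 ∧
    ω i.succ = ω i.castSucc + fun j => (e j : ZMod r)

/-- The weakly self-avoiding walk two-point function on `ℤ^d` (with values in `ℝ≥0∞`). -/
noncomputable def wsawG (d : ℕ) (β z : ℝ) (x : Fin d → ℤ) : ℝ≥0∞ :=
  ∑' p : (Σ n : ℕ,
      {ω : Fin (n + 1) → Fin d → ℤ // IsZWalk d n ω ∧ ω (Fin.last n) = x}),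
    ENNReal.ofReal (z ^ p.1 * Kint β p.1 p.2.1)

/-- The weakly self-avoiding walk two-point function on the torus `(ℤ/rℤ)^d`. -/
noncomputable def wsawGT (d r : ℕ) (β z : ℝ) (x : Fin d → ZMod r) : ℝ≥0∞ :=
  ∑' p : (Σ n : ℕ,
      {ω : Fin (n + 1) → Fin d → ZMod r // IsTWalk d r n ω ∧ ω (Fin.last n) = x}),
    ENNReal.ofReal (z ^ p.1 * Kint β p.1 p.2.1)

/-- Coordinatewise reduction modulo `r`, the projection of `ℤ^d` onto the torus. -/
def torusProj (d r : ℕ) (x : Fin d → ℤ) : Fin d → ZMod r := fun j => (x j : ZMod r)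

/-- Applying a map to a walk can only create self-intersections, hence decreases its weight. -/
lemma Kint_comp_le {V W : Type*} [DecidableEq V] [DecidableEq W] {β : ℝ}
    (hβ : β ∈ Set.Icc (0 : ℝ) 1) (n : ℕ) (f : V → W) (w : Fin (n + 1) → V) :
    Kint β n (fun i => f (w i)) ≤ Kint β n w := by
  obtain ⟨h0, h1⟩ := hβ
  refine Finset.prod_le_prod (fun p _ => ?_) (fun p _ => ?_)
  · split_ifs <;> linarith
  · by_cases h : w p.1 = w p.2
    · simp [h]
    · rw [if_neg h]
      split_ifs <;> linarith

/-- Every torus walk unfolds to a walk on `ℤ^d`. -/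
lemma IsTWalk.exists_unfolding {d r n : ℕ} {ω : Fin (n + 1) → Fin d → ZMod r}
    (hω : IsTWalk d r n ω) :
    ∃ w : Fin (n + 1) → Fin d → ℤ, IsZWalk d n w ∧ (fun i => torusProj d r (w i)) = ω := by
  obtain ⟨h0, hs⟩ := hω
  choose e he hstep using hs
  let w : Fin (n + 1) → Fin d → ℤ :=
    fun i => Fin.induction (motive := fun _ => Fin d → ℤ) 0 (fun i v => v + e i) i
  have hw0 : w 0 = 0 := rfl
  have hw : ∀ i : Fin n, w i.succ = w i.castSucc + e i := fun i => by
    simp only [w, Fin.induction_succ]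
  refine ⟨w, ⟨hw0, fun i => ?_⟩, funext fun i => ?_⟩
  · simpa [hw] using he i
  · induction i using Fin.induction with
    | zero => rw [hw0, h0]; ext j; simp [torusProj]
    | succ i ih =>
      rw [hstep, ← ih, hw]
      ext j
      simp [torusProj]

/-- The torus two-point function is at most the sum of the `ℤ^d` two-point function over a
fibre of the projection. -/
lemma wsawGT_le_tsum_fiber (d r : ℕ) {β z : ℝ} (hβ : β ∈ Set.Icc (0 : ℝ) 1) (hz : 0 ≤ z)
    (y : Fin d → ZMod r) :
    wsawGT d r β z y ≤ ∑' x : {x : Fin d → ℤ // torusProj d r x = y}, wsawG d β z x := by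
  choose w hw hproj using
    fun p : (Σ n : ℕ, {ω : Fin (n + 1) → Fin d → ZMod r //
      IsTWalk d r n ω ∧ ω (Fin.last n) = y}) => p.2.2.1.exists_unfolding
  let F : (Σ n : ℕ, {ω : Fin (n + 1) → Fin d → ZMod r //
        IsTWalk d r n ω ∧ ω (Fin.last n) = y}) →
      Σ x : {x : Fin d → ℤ // torusProj d r x = y}, Σ n : ℕ,
        {ω : Fin (n + 1) → Fin d → ℤ // IsZWalk d n ω ∧ ω (Fin.last n) = x} :=
    fun p => ⟨⟨w p (Fin.last p.1), (congrFun (hproj p) _).trans p.2.2.2⟩,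
      p.1, w p, hw p, rfl⟩
  have hF : Function.Injective F := by
    have key : ∀ p, (⟨(F p).2.1, fun i => torusProj d r ((F p).2.2.1 i)⟩ :
        Σ n : ℕ, Fin (n + 1) → Fin d → ZMod r) = ⟨p.1, p.2.1⟩ := fun p => by
      simp only [F, hproj]
    intro p q hpq
    have h := key p
    rw [hpq, key q] at h
    obtain ⟨m, a, ha⟩ := p
    obtain ⟨n, b, hb⟩ := q
    obtain ⟨rfl, h⟩ := Sigma.mk.inj_iff.1 h
    obtain rfl := eq_of_heq h
    rfl
  unfold wsawG
  rw [← ENNReal.tsum_sigma (fun (x : {x : Fin d → ℤ // torusProj d r x = y})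
    (p : Σ n : ℕ, {ω : Fin (n + 1) → Fin d → ℤ //
      IsZWalk d n ω ∧ ω (Fin.last n) = x}) => ENNReal.ofReal (z ^ p.1 * Kint β p.1 p.2.1))]
  refine le_trans (ENNReal.tsum_le_tsum fun p => ?_)
    (ENNReal.tsum_comp_le_tsum_of_injective hF _)
  refine ENNReal.ofReal_le_ofReal (mul_le_mul_of_nonneg_left ?_ (pow_nonneg hz _))
  have h := Kint_comp_le hβ p.1 (torusProj d r) (w p)
  rwa [hproj] at h

/-- The torus two-point function of the weakly self-avoiding walk is dominated by the
unfolded sum: `G_z^𝕋(x) ≤ ∑_{u ∈ ℤ^d} G_z(x + ru)`; in particular the torus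
susceptibility is at most the `ℤ^d` susceptibility. -/
theorem wsaw_torus_unfolding_bound (d : ℕ) (hd : 1 ≤ d) (β : ℝ)
    (hβ : β ∈ Set.Ioo (0:ℝ) 1) (z : ℝ) (hz : 0 ≤ z) (r : ℕ) (hr : 3 ≤ r) :
    (∀ x : Fin d → ℤ, (∀ j, -(r : ℤ) ≤ 2 * x j ∧ 2 * x j < r) →
      wsawGT d r β z (fun j => (x j : ZMod r))
        ≤ ∑' u : Fin d → ℤ, wsawG d β z (x + (r : ℤ) • u)) ∧
    (∑' x : Fin d → ZMod r, wsawGT d r β z x) ≤ ∑' x : Fin d → ℤ, wsawG d β z x := by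
  have hβ' : β ∈ Set.Icc (0 : ℝ) 1 := Set.Ioo_subset_Icc_self hβ
  constructor
  · intro x _
    refine (wsawGT_le_tsum_fiber d r hβ' hz _).trans ?_
    have hex : ∀ x' : {x' : Fin d → ℤ // torusProj d r x' = fun j => (x j : ZMod r)},
        ∃ u : Fin d → ℤ, (x' : Fin d → ℤ) = x + (r : ℤ) • u := by
      rintro ⟨x', hx'⟩
      have hdvd : ∀ j, (r : ℤ) ∣ x' j - x j := fun j =>
        (ZMod.intCast_eq_intCast_iff_dvd_sub _ _ _).1 (congrFun hx' j).symm
      choose u hu using hdvd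
      refine ⟨u, funext fun j => ?_⟩
      simp only [Pi.add_apply, Pi.smul_apply, smul_eq_mul]
      linarith [hu j]
    choose u hu using hex
    have hinj : Function.Injective u := fun a b hab =>
      Subtype.ext (by rw [hu a, hu b, hab])
    refine le_trans (ENNReal.tsum_le_tsum fun x' => ?_)
      (ENNReal.tsum_comp_le_tsum_of_injective hinj _)
    rw [hu x']
  · refine (ENNReal.tsum_le_tsum fun y => wsawGT_le_tsum_fiber d r hβ' hz y).trans ?_
    rw [← ENNReal.tsum_sigma (fun (y : Fin d → ZMod r)
      (x : {x : Fin d → ℤ // torusProj d r x = y}) => wsawG d β z x)]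
    exact ((Equiv.sigmaFiberEquiv (torusProj d r)).tsum_eq (wsawG d β z)).le
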